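/- arXiv:2510.03466 — 3 statements merged into one kernel-verified Lean document; each statement's English description precedes it below -/
import Mathlib

section
/- Let Θ ⊆ ℝ^d be open with θ* ∈ Θ, let ℱ be a compact metric space, and let 𝒢 : Θ × ℱ → (0,∞) be continuous. Suppose the rates are s_i(θ) = 𝒢(θ; α_i) for a sequence α_1, α_2, … ∈ ℱ, and suppose that for every θ ≠ θ* and every α ∈ ℱ one has 𝒢(θ; α) ≠ 𝒢(θ*; α). Then condition (A2) holds, namely: (i) for every θ ≠ θ*, limsup_{n→∞} (1/n)·Σ_{i=1}^n [𝒢(θ*;α_i)·log(𝒢(θ;α_i)/𝒢(θ*;α_i)) − (𝒢(θ;α_i) − 𝒢(θ*;α_i))] < 0; and (ii) there exists ρ > 0 (with the sphere ‖θ − θ*‖ = ρ contained in Θ) such that limsup_{n→∞} (1/n)·sup_{‖θ−θ*‖=ρ} Σ_{i=1}^n [𝒢(θ*;α_i)·log(𝒢(θ;α_i)/𝒢(θ*;α_i)) − (𝒢(θ;α_i) − 𝒢(θ*;α_i))] < 0. -/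
open scoped BigOperators

/-- A strict form of the Gibbs inequality for Poisson rates: the expected log-likelihood ratio of
two distinct rates is negative. -/
lemma poisson_expected_logLikelihoodRatio_neg {x y : ℝ} (hx : 0 < x) (hy : 0 < y) (hxy : x ≠ y) :
    y * Real.log (x / y) - (x - y) < 0 := by
  have hlog : Real.log (x / y) < x / y - 1 :=
    Real.log_lt_sub_one_of_pos (div_pos hx hy) fun h => hxy ((div_eq_one_iff_eq hy.ne').1 h)
  have hmul := mul_lt_mul_of_pos_left hlog hy
  have heq : y * (x / y - 1) = x - y := by field_simp
  linarith

/-- A sequence trapped between two negative multiples of `n` has averages with negative limsup. -/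
lemma limsup_average_neg {u : ℕ → ℝ} {m c : ℝ} (hc : c < 0)
    (hlower : ∀ n : ℕ, n * m ≤ u n) (hupper : ∀ n : ℕ, u n ≤ n * c) :
    Filter.limsup (fun n : ℕ => (1 / (n : ℝ)) * u n) Filter.atTop < 0 := by
  have hbelow : ∀ᶠ n : ℕ in Filter.atTop, m ≤ (1 / (n : ℝ)) * u n := by
    filter_upwards [Filter.eventually_gt_atTop 0] with n hn
    have hn' : (0 : ℝ) < n := Nat.cast_pos.2 hn
    rw [one_div, ← div_eq_inv_mul, le_div_iff₀ hn', mul_comm]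
    exact hlower n
  have habove : ∀ᶠ n : ℕ in Filter.atTop, (1 / (n : ℝ)) * u n ≤ c := by
    filter_upwards [Filter.eventually_gt_atTop 0] with n hn
    have hn' : (0 : ℝ) < n := Nat.cast_pos.2 hn
    rw [one_div, ← div_eq_inv_mul, div_le_iff₀ hn', mul_comm]
    exact hupper n
  exact (Filter.limsup_le_of_le
    (Filter.isBoundedUnder_of_eventually_ge hbelow).isCoboundedUnder_le habove).trans_lt hc

/-- If `h` is continuous and negative on `K × F` with `K` and `F` compact, then the averages of
the suprema over `K` of the partial sums of `h · (α i)` have negative limsup. -/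
lemma limsup_average_sSup_neg {X F : Type*} [TopologicalSpace X] [TopologicalSpace F]
    [CompactSpace F] [Nonempty F] {K : Set X} (hK : IsCompact K) (hKne : K.Nonempty)
    {h : X → F → ℝ}
    (hcont : ContinuousOn (fun p : X × F => h p.1 p.2) (K ×ˢ (Set.univ : Set F)))
    (hneg : ∀ x ∈ K, ∀ a, h x a < 0) (α : ℕ → F) :
    Filter.limsup (fun n : ℕ => (1 / (n : ℝ)) *
      sSup ((fun x => ∑ i ∈ Finset.range n, h x (α i)) '' K)) Filter.atTop < 0 := by
  have hcompact : IsCompact (K ×ˢ (Set.univ : Set F)) := hK.prod isCompact_univ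
  have hne : (K ×ˢ (Set.univ : Set F)).Nonempty := hKne.prod Set.univ_nonempty
  obtain ⟨p, hp, hmax⟩ := hcompact.exists_isMaxOn hne hcont
  obtain ⟨q, -, hmin⟩ := hcompact.exists_isMinOn hne hcont
  have hle : ∀ x ∈ K, ∀ n : ℕ, ∑ i ∈ Finset.range n, h x (α i) ≤ n * h p.1 p.2 := by
    intro x hx n
    simpa using Finset.sum_le_card_nsmul (Finset.range n) (fun i => h x (α i)) (h p.1 p.2)
      fun i _ => hmax (show (x, α i) ∈ K ×ˢ Set.univ from ⟨hx, trivial⟩)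
  have hge : ∀ x ∈ K, ∀ n : ℕ, n * h q.1 q.2 ≤ ∑ i ∈ Finset.range n, h x (α i) := by
    intro x hx n
    simpa using Finset.card_nsmul_le_sum (Finset.range n) (fun i => h x (α i)) (h q.1 q.2)
      fun i _ => hmin (show (x, α i) ∈ K ×ˢ Set.univ from ⟨hx, trivial⟩)
  refine limsup_average_neg (hneg p.1 hp.1 p.2) (m := h q.1 q.2) (fun n => ?_) fun n => ?_
  · obtain ⟨x, hx⟩ := hKne
    refine (hge x hx n).trans (le_csSup ⟨n * h p.1 p.2, ?_⟩ (Set.mem_image_of_mem _ hx))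
    rintro _ ⟨y, hy, rfl⟩
    exact hle y hy n
  · refine csSup_le (hKne.image _) ?_
    rintro _ ⟨y, hy, rfl⟩
    exact hle y hy n

/-- a sufficient condition for the identifiability condition (A2).
Let `Θ ⊆ ℝ^d` (`d ≥ 1`) be open with `θ* ∈ Θ`, let `ℱ` be a compact metric space, and let
`𝒢 : Θ × ℱ → (0,∞)` be continuous.  Suppose the rates are `s_i(θ) = 𝒢(θ; α_i)` for a sequence
`α₁, α₂, … ∈ ℱ`, and that `𝒢(θ; α) ≠ 𝒢(θ*; α)` whenever `θ ∈ Θ`, `θ ≠ θ*`.  Then (A2) holds: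
(i) for every `θ ∈ Θ`, `θ ≠ θ*`,
`limsup_n (1/n)·Σ_{i<n} [𝒢(θ*;α_i)·log(𝒢(θ;α_i)/𝒢(θ*;α_i)) − (𝒢(θ;α_i) − 𝒢(θ*;α_i))] < 0`;
(ii) there exists `ρ > 0`, with the sphere `‖θ − θ*‖ = ρ` contained in `Θ`, such that
`limsup_n (1/n)·sup_{‖θ−θ*‖=ρ} Σ_{i<n} [⋯] < 0`. -/
theorem identifiability_of_compact_family
    (d : ℕ) (hd : 0 < d)
    (Θ : Set (EuclideanSpace ℝ (Fin d))) (hΘ : IsOpen Θ)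
    (θstar : EuclideanSpace ℝ (Fin d)) (hθstar : θstar ∈ Θ)
    (F : Type*) [MetricSpace F] [CompactSpace F] [Nonempty F]
    (G : EuclideanSpace ℝ (Fin d) → F → ℝ)
    (hG_pos : ∀ θ ∈ Θ, ∀ α : F, 0 < G θ α)
    (hG_cont : ContinuousOn (fun p : EuclideanSpace ℝ (Fin d) × F => G p.1 p.2)
      (Θ ×ˢ (Set.univ : Set F)))
    (α : ℕ → F)
    (hident : ∀ θ ∈ Θ, θ ≠ θstar → ∀ a : F, G θ a ≠ G θstar a) :
    -- (i)
    (∀ θ ∈ Θ, θ ≠ θstar →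
      Filter.limsup
        (fun n : ℕ => (1 / (n : ℝ)) * ∑ i ∈ Finset.range n,
          (G θstar (α i) * Real.log (G θ (α i) / G θstar (α i)) - (G θ (α i) - G θstar (α i))))
        Filter.atTop < 0)
    -- (ii)
    ∧ (∃ ρ : ℝ, 0 < ρ ∧ Metric.sphere θstar ρ ⊆ Θ ∧
        Filter.limsup
          (fun n : ℕ => (1 / (n : ℝ)) *
            sSup ((fun θ => ∑ i ∈ Finset.range n,
              (G θstar (α i) * Real.log (G θ (α i) / G θstar (α i))
                - (G θ (α i) - G θstar (α i)))) '' Metric.sphere θstar ρ))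
          Filter.atTop < 0) := by
  have key : ∀ K ⊆ Θ, IsCompact K → K.Nonempty → θstar ∉ K →
      Filter.limsup
        (fun n : ℕ => (1 / (n : ℝ)) *
          sSup ((fun θ => ∑ i ∈ Finset.range n,
            (G θstar (α i) * Real.log (G θ (α i) / G θstar (α i))
              - (G θ (α i) - G θstar (α i)))) '' K))
        Filter.atTop < 0 := by
    intro K hKΘ hK hKne hKstar
    refine limsup_average_sSup_neg hK hKne (h := fun θ a =>
      G θstar a * Real.log (G θ a / G θstar a) - (G θ a - G θstar a)) ?_ ?_ α
    · have hG : ContinuousOn (fun p : EuclideanSpace ℝ (Fin d) × F => G p.1 p.2)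
          (K ×ˢ (Set.univ : Set F)) := hG_cont.mono (Set.prod_mono_left hKΘ)
      have hGstar : ContinuousOn (fun p : EuclideanSpace ℝ (Fin d) × F => G θstar p.2)
          (K ×ˢ (Set.univ : Set F)) :=
        hG_cont.comp (f := fun p : EuclideanSpace ℝ (Fin d) × F => (θstar, p.2))
          (by fun_prop) fun _ _ => ⟨hθstar, trivial⟩
      refine (hGstar.mul ((hG.div hGstar fun p _ => (hG_pos _ hθstar _).ne').log
        fun p hp => ?_)).sub (hG.sub hGstar)
      exact (div_pos (hG_pos _ (hKΘ hp.1) _) (hG_pos _ hθstar _)).ne'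
    · intro θ hθ a
      exact poisson_expected_logLikelihoodRatio_neg (hG_pos _ (hKΘ hθ) _) (hG_pos _ hθstar _)
        (hident θ (hKΘ hθ) (fun h => hKstar (h ▸ hθ)) a)
  refine ⟨fun θ hθ hne => ?_, ?_⟩
  · simpa only [Set.image_singleton, csSup_singleton] using
      key {θ} (Set.singleton_subset_iff.2 hθ) isCompact_singleton (Set.singleton_nonempty θ)
        fun h => hne (Set.mem_singleton_iff.1 h).symm
  · obtain ⟨ρ, hρ, hball⟩ := Metric.nhds_basis_closedBall.mem_iff.1 (hΘ.mem_nhds hθstar)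
    have hsub : Metric.sphere θstar ρ ⊆ Θ := Metric.sphere_subset_closedBall.trans hball
    have : Nonempty (Fin d) := ⟨⟨0, hd⟩⟩
    refine ⟨ρ, hρ, hsub, key _ hsub (isCompact_sphere θstar ρ)
      (NormedSpace.sphere_nonempty.2 hρ.le) fun h => ?_⟩
    rw [Metric.mem_sphere, dist_self] at h
    exact hρ.ne h
end

section
/- The Poisson cross-cumulant κ₁₁ vanishes in the large-rate limit: κ₁₁(s) = E_{N~Poisson(s)}[(c(s,N) − E[c(s,N)])·(N − s)] → 0 as s → ∞. -/
noncomputable section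

/-- Poisson probability mass function with rate `s` at `k`. -/
def poissonPMF (s : ℝ) (k : ℕ) : ℝ := s ^ k * Real.exp (-s) / (k.factorial : ℝ)

/-- Per-bin contribution to the C statistic: `c(s,N) = 2[s − N log s − N + N log N]`
(with the convention `0 · log 0 = 0`, automatic since `Real.log 0 = 0`). -/
def cBin (s : ℝ) (k : ℕ) : ℝ :=
  2 * (s - (k : ℝ) * Real.log s - (k : ℝ) + (k : ℝ) * Real.log (k : ℝ))

/-- Expectation of `g(N)` for `N ~ Poisson(s)`. -/
def pE (s : ℝ) (g : ℕ → ℝ) : ℝ := ∑' k : ℕ, poissonPMF s k * g k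

/-- First cumulant `κ₁(s) = E[c(s,N)]`. -/
def κ₁ (s : ℝ) : ℝ := pE s (cBin s)

/-- Cross-cumulant `κ₁₁(s) = E[(c(s,N) − κ₁(s))·(N − s)]`. -/
def κ₁₁ (s : ℝ) : ℝ := pE s (fun k => (cBin s k - κ₁ s) * ((k : ℝ) - s))

/-- The quartic Taylor remainder of `log (1 + x)` is increasing. -/
lemma monotoneOn_log_one_add_remainder :
    MonotoneOn (fun x : ℝ => Real.log (1 + x) - (x - x ^ 2 / 2 + x ^ 3 / 3 - x ^ 4 / 4))
      (Set.Ioi (-1)) := by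
  have hd : ∀ x ∈ Set.Ioi (-1 : ℝ), HasDerivAt
      (fun x : ℝ => Real.log (1 + x) - (x - x ^ 2 / 2 + x ^ 3 / 3 - x ^ 4 / 4))
      (x ^ 4 / (1 + x)) x := by
    intro x hx
    have hx' : 0 < 1 + x := by have := Set.mem_Ioi.1 hx; linarith
    have h1 := ((hasDerivAt_id x).const_add 1).log hx'.ne'
    have h2 := ((((hasDerivAt_id x).sub ((hasDerivAt_pow 2 x).div_const 2)).add
      ((hasDerivAt_pow 3 x).div_const 3)).sub ((hasDerivAt_pow 4 x).div_const 4))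
    refine (h1.sub h2).congr_deriv ?_
    simp only [id]
    field_simp
    push_cast
    ring
  refine monotoneOn_of_deriv_nonneg (convex_Ioi _)
    (fun x hx => (hd x hx).continuousAt.continuousWithinAt)
    (fun x hx => (hd x (interior_subset hx)).differentiableAt.differentiableWithinAt) ?_
  intro x hx
  have hx := interior_subset hx
  rw [(hd x hx).deriv]
  have hx' : 0 < 1 + x := by have := Set.mem_Ioi.1 hx; linarith
  positivity

/-- The quartic Taylor remainder of `log (1 + x)` grows more slowly than `x ^ 5 / (1 + x)`. -/
lemma monotoneOn_div_sub_log_one_add_remainder :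
    MonotoneOn (fun x : ℝ => x ^ 5 / (1 + x) -
      (Real.log (1 + x) - (x - x ^ 2 / 2 + x ^ 3 / 3 - x ^ 4 / 4))) (Set.Ioi (-1)) := by
  have hd : ∀ x ∈ Set.Ioi (-1 : ℝ), HasDerivAt
      (fun x : ℝ => x ^ 5 / (1 + x) -
        (Real.log (1 + x) - (x - x ^ 2 / 2 + x ^ 3 / 3 - x ^ 4 / 4)))
      (x ^ 4 * (4 + 3 * x) / (1 + x) ^ 2) x := by
    intro x hx
    have hx' : 0 < 1 + x := by have := Set.mem_Ioi.1 hx; linarith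
    have h0 := (hasDerivAt_pow 5 x).div ((hasDerivAt_id x).const_add 1) hx'.ne'
    have h1 := ((hasDerivAt_id x).const_add 1).log hx'.ne'
    have h2 := ((((hasDerivAt_id x).sub ((hasDerivAt_pow 2 x).div_const 2)).add
      ((hasDerivAt_pow 3 x).div_const 3)).sub ((hasDerivAt_pow 4 x).div_const 4))
    refine (h0.sub (h1.sub h2)).congr_deriv ?_
    simp only [id]
    field_simp
    push_cast
    ring
  refine monotoneOn_of_deriv_nonneg (convex_Ioi _)
    (fun x hx => (hd x hx).continuousAt.continuousWithinAt)
    (fun x hx => (hd x (interior_subset hx)).differentiableAt.differentiableWithinAt) ?_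
  intro x hx
  have hx := interior_subset hx
  rw [(hd x hx).deriv]
  have hx' : 0 < 1 + x := by have := Set.mem_Ioi.1 hx; linarith
  have : 0 < 4 + 3 * x := by linarith
  positivity

lemma mul_nonneg_of_monotoneOn_Ioi {f : ℝ → ℝ} (hf : MonotoneOn f (Set.Ioi (-1)))
    (h0 : f 0 = 0) {x : ℝ} (hx : -1 < x) : 0 ≤ x * f x := by
  rcases le_total 0 x with h | h
  · have := hf (by norm_num : (0 : ℝ) ∈ Set.Ioi (-1)) hx h
    exact mul_nonneg h (h0 ▸ this)
  · have := hf hx (by norm_num : (0 : ℝ) ∈ Set.Ioi (-1)) h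
    exact mul_nonneg_of_nonpos_of_nonpos h (h0 ▸ this)

lemma mul_one_add_mul_log_bounds {x : ℝ} (hx : -1 ≤ x) :
    x ^ 3 / 2 - x ^ 4 / 6 + x ^ 5 / 12 - x ^ 6 / 4 ≤ x * ((1 + x) * Real.log (1 + x) - x) ∧
    x * ((1 + x) * Real.log (1 + x) - x) ≤
      x ^ 3 / 2 - x ^ 4 / 6 + x ^ 5 / 12 - x ^ 6 / 4 + x ^ 6 := by
  rcases hx.eq_or_lt with rfl | hx
  · norm_num
  have hx' : 0 < 1 + x := by linarith
  have h1 := mul_nonneg hx'.le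
    (mul_nonneg_of_monotoneOn_Ioi monotoneOn_log_one_add_remainder (by norm_num) hx)
  have h2 := mul_nonneg hx'.le
    (mul_nonneg_of_monotoneOn_Ioi monotoneOn_div_sub_log_one_add_remainder (by norm_num) hx)
  have h3 : (1 + x) * (x * (x ^ 5 / (1 + x))) = x ^ 6 := by field_simp
  constructor <;> nlinarith

lemma poissonPMF_nonneg {s : ℝ} (hs : 0 ≤ s) (k : ℕ) : 0 ≤ poissonPMF s k := by
  unfold poissonPMF; positivity

lemma hasSum_poissonPMF (s : ℝ) : HasSum (poissonPMF s) 1 := by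
  have h := (NormedSpace.expSeries_div_hasSum_exp s).mul_right (Real.exp (-s))
  rw [← Real.exp_eq_exp_ℝ, ← Real.exp_add, add_neg_cancel, Real.exp_zero] at h
  refine h.congr_fun ?_
  intro k
  simp only [poissonPMF]
  ring

/-- The Poisson identity `E[N f(N)] = s E[f(N + 1)]`. -/
lemma HasSum.poissonPMF_mul_self {s a : ℝ} {f : ℕ → ℝ}
    (h : HasSum (fun k => poissonPMF s k * f (k + 1)) a) :
    HasSum (fun k => poissonPMF s k * (k * f k)) (s * a) := by
  rw [← hasSum_nat_add_iff' 1]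
  simp only [Finset.range_one, Finset.sum_singleton, Nat.cast_zero, zero_mul, mul_zero, sub_zero]
  refine (h.mul_left s).congr_fun fun k => ?_
  have : ((k : ℝ) + 1) ≠ 0 := by positivity
  have : (k.factorial : ℝ) ≠ 0 := by positivity
  simp only [poissonPMF, Nat.factorial_succ]
  push_cast
  field_simp
  ring

/-- The factorial moments of the Poisson distribution. -/
lemma hasSum_poissonPMF_mul_prod (s : ℝ) (j : ℕ) :
    HasSum (fun k : ℕ => poissonPMF s k * ∏ i ∈ Finset.range j, ((k : ℝ) - i)) (s ^ j) := by
  induction j with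
  | zero => simpa using hasSum_poissonPMF s
  | succ j ih =>
    have h := HasSum.poissonPMF_mul_self (s := s) (a := s ^ j)
      (f := fun k => ∏ i ∈ Finset.range j, ((k : ℝ) - (i + 1))) (by simpa using ih)
    rw [pow_succ']
    refine h.congr_fun fun k => ?_
    rw [Finset.prod_range_succ']
    simp [mul_comm]

/-- The central moments of the Poisson distribution of orders one and three to six. -/
lemma hasSum_poissonPMF_central (s : ℝ) :
    HasSum (fun k : ℕ => poissonPMF s k * ((k : ℝ) - s)) 0 ∧
    HasSum (fun k : ℕ => poissonPMF s k * ((k : ℝ) - s) ^ 3) s ∧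
    HasSum (fun k : ℕ => poissonPMF s k * ((k : ℝ) - s) ^ 4) (3 * s ^ 2 + s) ∧
    HasSum (fun k : ℕ => poissonPMF s k * ((k : ℝ) - s) ^ 5) (10 * s ^ 2 + s) ∧
    HasSum (fun k : ℕ => poissonPMF s k * ((k : ℝ) - s) ^ 6) (15 * s ^ 3 + 25 * s ^ 2 + s) := by
  have h (a b c d e f g : ℝ) :=
    (((((((hasSum_poissonPMF_mul_prod s 0).mul_left a).add
    ((hasSum_poissonPMF_mul_prod s 1).mul_left b)).add
    ((hasSum_poissonPMF_mul_prod s 2).mul_left c)).add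
    ((hasSum_poissonPMF_mul_prod s 3).mul_left d)).add
    ((hasSum_poissonPMF_mul_prod s 4).mul_left e)).add
    ((hasSum_poissonPMF_mul_prod s 5).mul_left f)).add
    ((hasSum_poissonPMF_mul_prod s 6).mul_left g)
  simp only [Finset.prod_range_succ, Finset.prod_range_zero] at h
  push_cast at h
  have aux {f g : ℕ → ℝ} {a b : ℝ} (hf : HasSum f a) (hg : ∀ k, g k = f k) (hb : b = a) :
      HasSum g b := by
    rwa [funext hg, hb]
  refine ⟨?_, ?_, ?_, ?_, ?_⟩
  · exact aux (h (-s) 1 0 0 0 0 0) (fun k => by ring) (by ring)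
  · exact aux (h (-s ^ 3) (1 - 3 * s + 3 * s ^ 2) (3 - 3 * s) 1 0 0 0)
      (fun k => by ring) (by ring)
  · exact aux (h (s ^ 4) (1 - 4 * s + 6 * s ^ 2 - 4 * s ^ 3) (7 - 12 * s + 6 * s ^ 2) (6 - 4 * s)
      1 0 0) (fun k => by ring) (by ring)
  · exact aux (h (-s ^ 5) (1 - 5 * s + 10 * s ^ 2 - 10 * s ^ 3 + 5 * s ^ 4)
      (15 - 35 * s + 30 * s ^ 2 - 10 * s ^ 3) (25 - 30 * s + 10 * s ^ 2) (10 - 5 * s) 1 0)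
      (fun k => by ring) (by ring)
  · exact aux (h (s ^ 6) (1 - 6 * s + 15 * s ^ 2 - 20 * s ^ 3 + 15 * s ^ 4 - 6 * s ^ 5)
      (31 - 90 * s + 105 * s ^ 2 - 60 * s ^ 3 + 15 * s ^ 4)
      (90 - 150 * s + 90 * s ^ 2 - 20 * s ^ 3) (65 - 60 * s + 15 * s ^ 2) (15 - 6 * s) 1)
      (fun k => by ring) (by ring)

lemma cBin_mul_sub_eq {s : ℝ} (hs : 0 < s) (k : ℕ) :
    cBin s k * (k - s) = 2 * s ^ 2 * (((k : ℝ) - s) / s *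
      ((1 + ((k : ℝ) - s) / s) * Real.log (1 + ((k : ℝ) - s) / s) - ((k : ℝ) - s) / s)) := by
  have h1 : 1 + ((k : ℝ) - s) / s = k / s := by field_simp; ring
  rw [h1, cBin]
  rcases Nat.eq_zero_or_pos k with rfl | hk
  · simp; field_simp
  · have hk : (k : ℝ) ≠ 0 := by positivity
    rw [Real.log_div hk hs.ne']
    field_simp
    ring

lemma kappa11_bounds {s : ℝ} (hs : 0 < s) :
    -(37 / 6) * s⁻¹ - 37 / 3 * s⁻¹ ^ 2 - s⁻¹ ^ 3 / 2 ≤ κ₁₁ s ∧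
    κ₁₁ s ≤ 143 / 6 * s⁻¹ + 113 / 3 * s⁻¹ ^ 2 + 3 / 2 * s⁻¹ ^ 3 := by
  obtain ⟨m1, m3, m4, m5, m6⟩ := hasSum_poissonPMF_central s
  have hlow := (((m3.mul_left (s⁻¹)).sub (m4.mul_left (s⁻¹ ^ 2 / 3))).add
    (m5.mul_left (s⁻¹ ^ 3 / 6))).sub (m6.mul_left (s⁻¹ ^ 4 / 2))
  have hgap := m6.mul_left (2 * s⁻¹ ^ 4)
  have hb (k : ℕ) := mul_one_add_mul_log_bounds (x := ((k : ℝ) - s) / s) (by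
    rw [le_div_iff₀ hs]; have : (0 : ℝ) ≤ k := by positivity
    linarith)
  have hle (k : ℕ) : s⁻¹ * (poissonPMF s k * ((k : ℝ) - s) ^ 3) -
      s⁻¹ ^ 2 / 3 * (poissonPMF s k * ((k : ℝ) - s) ^ 4) +
      s⁻¹ ^ 3 / 6 * (poissonPMF s k * ((k : ℝ) - s) ^ 5) -
      s⁻¹ ^ 4 / 2 * (poissonPMF s k * ((k : ℝ) - s) ^ 6) ≤
      poissonPMF s k * (cBin s k * (k - s)) := by
    rw [cBin_mul_sub_eq hs]
    refine le_trans (le_of_eq ?_) (mul_le_mul_of_nonneg_left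
      (mul_le_mul_of_nonneg_left (hb k).1 (by positivity : 0 ≤ 2 * s ^ 2))
      (poissonPMF_nonneg hs.le k))
    field_simp
    ring
  have hge (k : ℕ) : poissonPMF s k * (cBin s k * (k - s)) ≤
      s⁻¹ * (poissonPMF s k * ((k : ℝ) - s) ^ 3) -
      s⁻¹ ^ 2 / 3 * (poissonPMF s k * ((k : ℝ) - s) ^ 4) +
      s⁻¹ ^ 3 / 6 * (poissonPMF s k * ((k : ℝ) - s) ^ 5) -
      s⁻¹ ^ 4 / 2 * (poissonPMF s k * ((k : ℝ) - s) ^ 6) +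
      2 * s⁻¹ ^ 4 * (poissonPMF s k * ((k : ℝ) - s) ^ 6) := by
    rw [cBin_mul_sub_eq hs]
    refine le_trans (mul_le_mul_of_nonneg_left
      (mul_le_mul_of_nonneg_left (hb k).2 (by positivity : 0 ≤ 2 * s ^ 2))
      (poissonPMF_nonneg hs.le k)) (le_of_eq ?_)
    field_simp
    ring
  have hsum : Summable (fun k : ℕ => poissonPMF s k * (cBin s k * (k - s))) := by
    have := (Summable.of_nonneg_of_le (fun k => sub_nonneg.2 (hle k))
      (fun k => sub_le_iff_le_add'.2 (hge k)) hgap.summable).add hlow.summable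
    simpa only [sub_add_cancel] using this
  have hκ : HasSum (fun k : ℕ => poissonPMF s k * (cBin s k * (k - s))) (κ₁₁ s) := by
    have h := hsum.hasSum.sub (m1.mul_left (κ₁ s))
    have he : κ₁₁ s = ∑' k : ℕ, poissonPMF s k * (cBin s k * (k - s)) := by
      rw [κ₁₁, pE, ← sub_zero (∑' k : ℕ, poissonPMF s k * (cBin s k * (k - s))),
        ← mul_zero (κ₁ s), ← h.tsum_eq]
      congr 1
      ext k
      ring
    rw [he]
    exact hsum.hasSum
  constructor
  · refine le_trans (le_of_eq ?_) (hasSum_le hle hlow hκ)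
    field_simp
    ring
  · refine le_trans (hasSum_le hge hκ (hlow.add hgap)) (le_of_eq ?_)
    field_simp
    ring

/-- The Poisson cross-cumulant `κ₁₁` vanishes in the large-rate limit:
`κ₁₁(s) → 0` as `s → ∞`. -/
theorem kappa11_tendsto_zero : Filter.Tendsto κ₁₁ Filter.atTop (nhds 0) := by
  have h1 : Filter.Tendsto (fun s : ℝ => s⁻¹) Filter.atTop (nhds 0) := tendsto_inv_atTop_zero
  have hl : Filter.Tendsto (fun s : ℝ => -(37 / 6) * s⁻¹ - 37 / 3 * s⁻¹ ^ 2 - s⁻¹ ^ 3 / 2)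
      Filter.atTop (nhds 0) := by
    simpa using ((h1.const_mul (-(37 / 6))).sub ((h1.pow 2).const_mul (37 / 3))).sub
      ((h1.pow 3).div_const 2)
  have hu : Filter.Tendsto (fun s : ℝ => 143 / 6 * s⁻¹ + 113 / 3 * s⁻¹ ^ 2 + 3 / 2 * s⁻¹ ^ 3)
      Filter.atTop (nhds 0) := by
    simpa using ((h1.const_mul (143 / 6)).add ((h1.pow 2).const_mul (113 / 3))).add
      ((h1.pow 3).const_mul (3 / 2))
  refine tendsto_of_tendsto_of_tendsto_of_le_of_le' hl hu ?_ ?_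
  · filter_upwards [Filter.eventually_gt_atTop 0] with s hs using (kappa11_bounds hs).1
  · filter_upwards [Filter.eventually_gt_atTop 0] with s hs using (kappa11_bounds hs).2

end
end

section
/- Let N ~ Poisson(s) and c(s,N) = 2·[s − N·log s − N + N·log N]. Then: (i) for every s > 0 the variance Var(c(s,N)) is strictly positive; (ii) the maps s ↦ Var(c(s,N)) and s ↦ E|c(s,N) − E[c(s,N)]|³ are continuous on (0,∞); and consequently (iii) for any 0 < ε ≤ S < ∞ there exist constants M₁ > 0 and M₂ < ∞ such that Var(c(s,N)) ≥ M₁ and E|c(s,N) − E[c(s,N)]|³ ≤ M₂ for all s ∈ [ε, S]. -/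
noncomputable section

/-- Mean of `c(s,N)` for `N ~ Poisson(s)`. -/
def meanC (s : ℝ) : ℝ := pE s (cBin s)

/-- Variance of `c(s,N)` for `N ~ Poisson(s)`. -/
def varC (s : ℝ) : ℝ := pE s (fun k => (cBin s k - meanC s) ^ 2)

/-- Third absolute central moment `E|c(s,N) − E c(s,N)|³` for `N ~ Poisson(s)`. -/
def absMom3C (s : ℝ) : ℝ := pE s (fun k => |cBin s k - meanC s| ^ 3)

theorem poissonPMF_pos {s : ℝ} (hs : 0 < s) (k : ℕ) : 0 < poissonPMF s k := by
  unfold poissonPMF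
  positivity

theorem poissonPMF_le {s S : ℝ} (hs : 0 ≤ s) (hS : s ≤ S) (k : ℕ) :
    poissonPMF s k ≤ S ^ k / (k.factorial : ℝ) := by
  unfold poissonPMF
  have hexp : Real.exp (-s) ≤ 1 := Real.exp_le_one_iff.mpr (by linarith)
  have hpow : s ^ k ≤ S ^ k := by gcongr
  have hprod : s ^ k * Real.exp (-s) ≤ S ^ k :=
    (mul_le_of_le_one_right (by positivity) hexp).trans hpow
  gcongr

theorem norm_poissonPMF_mul_le {s S C R x : ℝ} (hs : 0 ≤ s) (hS : s ≤ S) (k : ℕ)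
    (hx : |x| ≤ C * R ^ k) :
    ‖poissonPMF s k * x‖ ≤ C * ((S * R) ^ k / (k.factorial : ℝ)) := by
  have hp : 0 ≤ poissonPMF s k := by
    unfold poissonPMF
    positivity
  have hq := poissonPMF_le hs hS k
  rw [Real.norm_eq_abs, abs_mul, abs_of_nonneg hp]
  calc poissonPMF s k * |x| ≤ S ^ k / (k.factorial : ℝ) * (C * R ^ k) :=
        mul_le_mul hq hx (abs_nonneg x) (hp.trans hq)
    _ = C * ((S * R) ^ k / (k.factorial : ℝ)) := by rw [mul_pow]; ring

theorem summable_poissonPMF_mul {s C R : ℝ} {g : ℕ → ℝ} (hs : 0 ≤ s)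
    (hg : ∀ k, |g k| ≤ C * R ^ k) : Summable fun k => poissonPMF s k * g k :=
  ((Real.summable_pow_div_factorial (s * R)).mul_left C).of_norm_bounded
    fun k => norm_poissonPMF_mul_le hs le_rfl k (hg k)

/-- Poisson expectations of an exponentially bounded family depend continuously on the rate. -/
theorem continuousOn_pE {ε S C R : ℝ} (hε : 0 < ε) {g : ℝ → ℕ → ℝ}
    (hcont : ∀ k, ContinuousOn (fun s => g s k) (Set.Icc ε S))
    (hg : ∀ s ∈ Set.Icc ε S, ∀ k, |g s k| ≤ C * R ^ k) :
    ContinuousOn (fun s => pE s (g s)) (Set.Icc ε S) := by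
  unfold pE
  refine continuousOn_tsum (u := fun k => C * ((S * R) ^ k / (k.factorial : ℝ))) (fun k => ?_)
    ((Real.summable_pow_div_factorial (S * R)).mul_left C) fun k s hs =>
      norm_poissonPMF_mul_le (hε.le.trans hs.1) hs.2 k (hg s hs k)
  have hpmf : Continuous fun s => poissonPMF s k := by
    unfold poissonPMF
    fun_prop
  exact hpmf.continuousOn.mul (hcont k)

theorem continuousOn_cBin {ε S : ℝ} (hε : 0 < ε) (k : ℕ) :
    ContinuousOn (fun s => cBin s k) (Set.Icc ε S) := by
  have hlog : ContinuousOn Real.log (Set.Icc ε S) :=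
    Real.continuousOn_log.mono fun s hs => (hε.trans_le hs.1).ne'
  unfold cBin
  fun_prop

theorem abs_cBin_le {s L : ℝ} (hs : 0 < s) (hL : |Real.log s| ≤ L) (k : ℕ) :
    |cBin s k| ≤ 2 * (s + L + 2) * 4 ^ k := by
  have hk0 : (0 : ℝ) ≤ k := k.cast_nonneg
  have hlogk : Real.log k ≤ k := Real.log_le_self hk0
  have hlogk0 : 0 ≤ Real.log k := Real.log_natCast_nonneg k
  have hk2 : ((k : ℝ) + 1) ^ 2 ≤ 4 ^ k := by
    have h : (k : ℝ) + 1 ≤ 2 ^ k := by exact_mod_cast k.lt_two_pow_self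
    calc ((k : ℝ) + 1) ^ 2 ≤ (2 ^ k) ^ 2 := by gcongr
      _ = 4 ^ k := by rw [← pow_mul, mul_comm, pow_mul]; norm_num
  have hL0 : 0 ≤ L := (abs_nonneg _).trans hL
  have hkL : |(k : ℝ) * Real.log s| ≤ k * L := by
    rw [abs_mul, abs_of_nonneg hk0]
    gcongr
  have hkk : (k : ℝ) * Real.log k ≤ k * k := by gcongr
  have hkk0 : 0 ≤ (k : ℝ) * Real.log k := by positivity
  have hbound : s + k * L + k + k * k ≤ (s + L + 2) * ((k : ℝ) + 1) ^ 2 := by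
    have h₁ : 0 ≤ s * ((k : ℝ) ^ 2 + 2 * k) := by positivity
    have h₂ : 0 ≤ L * ((k : ℝ) ^ 2 + k + 1) := by positivity
    nlinarith
  have hfinal : s + k * L + k + k * k ≤ (s + L + 2) * 4 ^ k := hbound.trans (by gcongr)
  obtain ⟨h₁, h₂⟩ := abs_le.mp hkL
  have hkL0 : 0 ≤ (k : ℝ) * L := by positivity
  rw [abs_le]
  unfold cBin
  constructor <;> nlinarith

theorem exists_abs_cBin_le {ε S : ℝ} (hε : 0 < ε) :
    ∃ A : ℝ, ∀ s ∈ Set.Icc ε S, ∀ k, |cBin s k| ≤ A * 4 ^ k := by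
  have hlog : ContinuousOn Real.log (Set.Icc ε S) :=
    Real.continuousOn_log.mono fun s hs => (hε.trans_le hs.1).ne'
  obtain ⟨L, hL⟩ := isCompact_Icc.exists_bound_of_continuousOn hlog
  refine ⟨2 * (S + L + 2), fun s hs k => ?_⟩
  refine (abs_cBin_le (hε.trans_le hs.1) (hL s hs) k).trans ?_
  gcongr
  exact hs.2

theorem continuousOn_meanC {ε S : ℝ} (hε : 0 < ε) : ContinuousOn meanC (Set.Icc ε S) := by
  obtain ⟨A, hA⟩ := exists_abs_cBin_le (S := S) hε
  exact continuousOn_pE hε (continuousOn_cBin hε) hA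

theorem exists_abs_cBin_sub_meanC_le {ε S : ℝ} (hε : 0 < ε) :
    ∃ A : ℝ, ∀ s ∈ Set.Icc ε S, ∀ k, |cBin s k - meanC s| ≤ A * 4 ^ k := by
  obtain ⟨A, hA⟩ := exists_abs_cBin_le (S := S) hε
  obtain ⟨B, hB⟩ := isCompact_Icc.exists_bound_of_continuousOn (continuousOn_meanC (S := S) hε)
  refine ⟨A + B, fun s hs k => ?_⟩
  have hB0 : 0 ≤ B := (norm_nonneg _).trans (hB s hs)
  calc |cBin s k - meanC s| ≤ |cBin s k| + |meanC s| := abs_sub _ _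
    _ ≤ A * 4 ^ k + B * 4 ^ k :=
        add_le_add (hA s hs k)
          ((hB s hs).trans (le_mul_of_one_le_right hB0 (one_le_pow₀ (by norm_num))))
    _ = (A + B) * 4 ^ k := by ring

theorem exists_abs_cBin_sub_meanC_pow_le {ε S : ℝ} (hε : 0 < ε) (n : ℕ) :
    ∃ C R : ℝ, ∀ s ∈ Set.Icc ε S, ∀ k, |cBin s k - meanC s| ^ n ≤ C * R ^ k := by
  obtain ⟨A, hA⟩ := exists_abs_cBin_sub_meanC_le (S := S) hε
  refine ⟨A ^ n, 4 ^ n, fun s hs k => ?_⟩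
  calc |cBin s k - meanC s| ^ n ≤ (A * 4 ^ k) ^ n := by gcongr; exact hA s hs k
    _ = A ^ n * (4 ^ n) ^ k := by rw [mul_pow, pow_right_comm]

theorem continuousOn_pE_abs_sub_pow {ε S : ℝ} (hε : 0 < ε) (n : ℕ) :
    ContinuousOn (fun s => pE s fun k => |cBin s k - meanC s| ^ n) (Set.Icc ε S) := by
  obtain ⟨C, R, hCR⟩ := exists_abs_cBin_sub_meanC_pow_le (S := S) hε n
  refine continuousOn_pE (C := C) (R := R) hε
    (fun k => ((continuousOn_cBin hε k).sub (continuousOn_meanC hε)).abs.pow n) fun s hs k => ?_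
  rw [abs_of_nonneg (by positivity)]
  exact hCR s hs k

theorem continuousOn_varC {ε S : ℝ} (hε : 0 < ε) : ContinuousOn varC (Set.Icc ε S) := by
  have h := continuousOn_pE_abs_sub_pow (S := S) hε 2
  simp only [sq_abs] at h
  exact h

theorem continuousOn_absMom3C {ε S : ℝ} (hε : 0 < ε) : ContinuousOn absMom3C (Set.Icc ε S) :=
  continuousOn_pE_abs_sub_pow hε 3

theorem continuousOn_Ioi_of_Icc {f : ℝ → ℝ}
    (hf : ∀ ε S : ℝ, 0 < ε → ContinuousOn f (Set.Icc ε S)) : ContinuousOn f (Set.Ioi 0) := by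
  intro s hs
  have hs0 : 0 < s := hs
  exact ((hf (s / 2) (s + 1) (by positivity)).continuousAt
    (Icc_mem_nhds (by linarith) (by linarith))).continuousWithinAt

/-- The values of the C statistic at the counts `0, 1, 2` cannot all coincide. -/
theorem exists_cBin_ne (s m : ℝ) : ∃ k, cBin s k ≠ m := by
  by_contra! h
  have h₀ := h 0
  have h₁ := h 1
  have h₂ := h 2
  simp only [cBin, Nat.cast_zero, Nat.cast_one, Nat.cast_ofNat, Real.log_one] at h₀ h₁ h₂
  have hlog : 0 < Real.log 2 := Real.log_pos one_lt_two
  linarith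

theorem varC_pos {s : ℝ} (hs : 0 < s) : 0 < varC s := by
  obtain ⟨C, R, hCR⟩ := exists_abs_cBin_sub_meanC_pow_le (S := s) hs 2
  obtain ⟨k, hk⟩ := exists_cBin_ne s (meanC s)
  have hsum : Summable fun k => poissonPMF s k * (cBin s k - meanC s) ^ 2 := by
    refine summable_poissonPMF_mul (C := C) (R := R) hs.le fun k => ?_
    rw [abs_pow]
    exact hCR s ⟨le_rfl, le_rfl⟩ k
  exact hsum.tsum_pos (fun j => mul_nonneg (poissonPMF_pos hs j).le (sq_nonneg _)) k
    (mul_pos (poissonPMF_pos hs k) (sq_pos_of_ne_zero (sub_ne_zero.mpr hk)))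

/-- For `N ~ Poisson(s)` and `c(s,N) = 2[s − N log s − N + N log N]`:
(i) `Var(c(s,N)) > 0` for every `s > 0`;
(ii) `s ↦ Var(c(s,N))` and `s ↦ E|c(s,N) − E c(s,N)|³` are continuous on `(0,∞)`;
(iii) for any `0 < ε ≤ S < ∞` there are constants `M₁ > 0`, `M₂ < ∞` with
`Var(c(s,N)) ≥ M₁` and `E|c(s,N) − E c(s,N)|³ ≤ M₂` for all `s ∈ [ε, S]`. -/
theorem cstat_moment_bounds :
    (∀ s : ℝ, 0 < s → 0 < varC s)
    ∧ (ContinuousOn varC (Set.Ioi (0 : ℝ)) ∧ ContinuousOn absMom3C (Set.Ioi (0 : ℝ)))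
    ∧ (∀ ε S : ℝ, 0 < ε → ε ≤ S →
        ∃ M₁ M₂ : ℝ, 0 < M₁ ∧
          ∀ s ∈ Set.Icc ε S, M₁ ≤ varC s ∧ absMom3C s ≤ M₂) := by
  refine ⟨fun s hs => varC_pos hs,
    ⟨continuousOn_Ioi_of_Icc fun _ _ => continuousOn_varC,
      continuousOn_Ioi_of_Icc fun _ _ => continuousOn_absMom3C⟩, fun ε S hε hS => ?_⟩
  obtain ⟨s₀, hs₀, hmin⟩ := isCompact_Icc.exists_isMinOn (Set.nonempty_Icc.mpr hS)
    (continuousOn_varC (S := S) hε)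
  obtain ⟨M, hM⟩ := isCompact_Icc.exists_bound_of_continuousOn (continuousOn_absMom3C (S := S) hε)
  exact ⟨varC s₀, M, varC_pos (hε.trans_le hs₀.1), fun s hs =>
    ⟨hmin hs, (le_abs_self _).trans (hM s hs)⟩⟩

end
end
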